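/- Let (Γ_t)_{t∈[0,T]} be a weakly continuous solution to the second-order equation (SP-FPK). Then the curve Γ̄_t := Γ_t ∘ H⁻¹ (the pushforward of Γ_t under H) is a weakly continuous solution to (ℓ²-FPK), and each Γ̄_t is concentrated on H(SP). -/

import Mathlib

open MeasureTheory Topology Filter

noncomputable section

/-- Euclidean space `ℝ^d`. -/
abbrev Rd (d : ℕ) := Fin d → ℝ

/-- The space of subprobability measures on `ℝ^d`. -/
def SP (d : ℕ) : Type := {μ : Measure (Rd d) // μ Set.univ ≤ 1}

/-- The vague topology on `SP d`: the initial topology of the maps `μ ↦ ∫ g dμ` for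
`g : ℝ^d → ℝ` continuous with compact support. -/
instance (d : ℕ) : TopologicalSpace (SP d) :=
  ⨅ g : {g : Rd d → ℝ // Continuous g ∧ HasCompactSupport g},
    TopologicalSpace.induced (fun μ : SP d => ∫ x, g.1 x ∂μ.1) inferInstance

instance (d : ℕ) : MeasurableSpace (SP d) := borel (SP d)
instance (d : ℕ) : BorelSpace (SP d) := ⟨rfl⟩

/-- First-order partial derivative `∂_i f`. -/
def pd {n : ℕ} (f : (Fin n → ℝ) → ℝ) (i : Fin n) (x : Fin n → ℝ) : ℝ :=
  fderiv ℝ f x (Pi.single i 1)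

/-- Second-order partial derivative `∂²_{ij} f`. -/
def pd2 {n : ℕ} (f : (Fin n → ℝ) → ℝ) (i j : Fin n) (x : Fin n → ℝ) : ℝ :=
  fderiv ℝ (fun y => pd f j y) x (Pi.single i 1)

/-- Twice continuously differentiable with compact support. -/
def IsC2c {n : ℕ} (φ : (Fin n → ℝ) → ℝ) : Prop :=
  ContDiff ℝ 2 φ ∧ HasCompactSupport φ

/-- Twice continuously differentiable, bounded, with bounded first and second order
partial derivatives. -/
def IsC2b {n : ℕ} (f : (Fin n → ℝ) → ℝ) : Prop :=
  ContDiff ℝ 2 f ∧ ∃ M : ℝ, ∀ x, |f x| ≤ M ∧ (∀ i, |pd f i x| ≤ M) ∧ ∀ i j, |pd2 f i j x| ≤ M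

/-- Borel coefficients, with `a` symmetric and positive semidefinite (`S⁺_d`-valued). -/
def GoodCoeffs (d : ℕ) (a : ℝ → SP d → Rd d → Fin d → Fin d → ℝ)
    (b : ℝ → SP d → Rd d → Fin d → ℝ) : Prop :=
  (∀ i j, Measurable fun p : ℝ × SP d × Rd d => a p.1 p.2.1 p.2.2 i j) ∧
  (∀ i, Measurable fun p : ℝ × SP d × Rd d => b p.1 p.2.1 p.2.2 i) ∧
  (∀ t μ x i j, a t μ x i j = a t μ x j i) ∧
  (∀ t μ x (v : Fin d → ℝ), 0 ≤ ∑ i, ∑ j, v i * a t μ x i j * v j)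

/-- The Kolmogorov operator `L_{t,μ}φ = ∑ a_ij ∂²_ij φ + ∑ b_i ∂_i φ`. -/
def Lop {d : ℕ} (a : ℝ → SP d → Rd d → Fin d → Fin d → ℝ)
    (b : ℝ → SP d → Rd d → Fin d → ℝ) (t : ℝ) (μ : SP d) (φ : Rd d → ℝ) (x : Rd d) : ℝ :=
  (∑ i, ∑ j, a t μ x i j * pd2 φ i j x) + ∑ i, b t μ x i * pd φ i x

/-- Global integrability condition for (NLFPK). -/
def NLFPKIntegrable (d : ℕ) (T : ℝ) (a : ℝ → SP d → Rd d → Fin d → Fin d → ℝ)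
    (b : ℝ → SP d → Rd d → Fin d → ℝ) (μ : ℝ → SP d) : Prop :=
  ∀ i j, ∫⁻ t in Set.Ioc (0:ℝ) T,
      ∫⁻ x, ENNReal.ofReal (|a t (μ t) x i j| + |b t (μ t) x i|) ∂(μ t).1 < ⊤

/-- The weak form of the nonlinear FPK equation, tested against `φ` at time `t`. -/
def NLFPKEq (d : ℕ) (a : ℝ → SP d → Rd d → Fin d → Fin d → ℝ)
    (b : ℝ → SP d → Rd d → Fin d → ℝ) (μ : ℝ → SP d) (φ : Rd d → ℝ) (t : ℝ) : Prop :=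
  ∫ x, φ x ∂(μ t).1 - ∫ x, φ x ∂(μ 0).1 = ∫ s in (0:ℝ)..t, ∫ x, Lop a b s (μ s) φ x ∂(μ s).1

/-- Subprobability solution to (NLFPK): a vaguely continuous, globally integrable curve
in `SP` satisfying the weak equation for all test functions in `C²_c(ℝ^d)`. -/
def IsSubprobSolution (d : ℕ) (T : ℝ) (a : ℝ → SP d → Rd d → Fin d → Fin d → ℝ)
    (b : ℝ → SP d → Rd d → Fin d → ℝ) (μ : ℝ → SP d) : Prop :=
  ContinuousOn μ (Set.Icc 0 T) ∧ NLFPKIntegrable d T a b μ ∧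
  ∀ φ : Rd d → ℝ, IsC2c φ → ∀ t ∈ Set.Icc (0:ℝ) T, NLFPKEq d a b μ φ t

/-- Weak continuity (in duality with bounded continuous functions) of a curve in `SP`. -/
def WeaklyContinuousOn {d : ℕ} (μ : ℝ → SP d) (s : Set ℝ) : Prop :=
  ∀ f : Rd d → ℝ, Continuous f → (∃ M, ∀ x, |f x| ≤ M) →
    ContinuousOn (fun t => ∫ x, f x ∂(μ t).1) s

/-- Probability solution to (NLFPK): a weakly continuous solution consisting of
probability measures. -/
def IsProbSolution (d : ℕ) (T : ℝ) (a : ℝ → SP d → Rd d → Fin d → Fin d → ℝ)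
    (b : ℝ → SP d → Rd d → Fin d → ℝ) (μ : ℝ → SP d) : Prop :=
  IsSubprobSolution d T a b μ ∧ (∀ t ∈ Set.Icc (0:ℝ) T, (μ t).1 Set.univ = 1) ∧
  WeaklyContinuousOn μ (Set.Icc 0 T)

/-- `φ` and `ψ` are uniformly `ε`-close, together with their first and second order
partial derivatives (closeness in the `C²_b` norm). -/
def C2Close {n : ℕ} (φ ψ : (Fin n → ℝ) → ℝ) (ε : ℝ) : Prop :=
  (∀ x, |φ x - ψ x| ≤ ε) ∧ (∀ i x, |pd φ i x - pd ψ i x| ≤ ε) ∧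
  ∀ i j x, |pd2 φ i j x - pd2 ψ i j x| ≤ ε

/-- A countable family `g i ∈ C²_c(ℝ^d) \ {0}` which is dense in `C²_c(ℝ^d)` with respect
to the `C²_b` norm. -/
def GFamily (d : ℕ) (g : ℕ → Rd d → ℝ) : Prop :=
  (∀ i, IsC2c (g i)) ∧ (∀ i, g i ≠ 0) ∧
  ∀ φ : Rd d → ℝ, IsC2c φ → ∀ ε : ℝ, 0 < ε → ∃ i, C2Close (g i) φ ε

/-- The global chart `G : SP → ℝ^∞`, `G(μ) = (μ(g_i))_i`. -/
def Gmap {d : ℕ} (g : ℕ → Rd d → ℝ) (μ : SP d) : ℕ → ℝ := fun i => ∫ x, g i x ∂μ.1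

/-- The `C²_b`-norm `max(‖φ‖_∞, ‖∂_iφ‖_∞, ‖∂²_{ij}φ‖_∞)`. -/
def c2bNorm {d : ℕ} (φ : Rd d → ℝ) : ℝ :=
  ⨆ x : Rd d, max |φ x| (max (⨆ i, |pd φ i x|) (⨆ i, ⨆ j, |pd2 φ i j x|))

/-- The renormalized family `h_i := 2^{-(i+1)} g_i / ‖g_i‖_{C²_b}`. -/
def hfun {d : ℕ} (g : ℕ → Rd d → ℝ) (i : ℕ) : Rd d → ℝ :=
  fun x => (2 : ℝ)⁻¹ ^ (i + 1) * (g i x / c2bNorm (g i))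

/-- The Hilbert space `ℓ²` of square-summable real sequences. -/
abbrev E2 : Type := lp (fun _ : ℕ => ℝ) 2

instance : MeasurableSpace E2 := borel E2
instance : BorelSpace E2 := ⟨rfl⟩

open scoped Classical

/-- `F(μ) = f(μ(h_1),…,μ(h_n))`, a typical element of `FC²_b(H)`. -/
def Hof {d : ℕ} (g : ℕ → Rd d → ℝ) {n : ℕ} (f : (Fin n → ℝ) → ℝ) (μ : SP d) : ℝ :=
  f fun k : Fin n => ∫ x, hfun g k x ∂μ.1

/-- `Σ^α_k(t,μ) = ∫ σ^α(t,μ,x)·∇h_k(x) dμ(x)`. -/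
def sigGrad {d d₁ : ℕ} (σ : ℝ → SP d → Rd d → Fin d → Fin d₁ → ℝ) (g : ℕ → Rd d → ℝ)
    (α : Fin d₁) (k : ℕ) (t : ℝ) (μ : SP d) : ℝ :=
  ∫ x, (∑ i, σ t μ x i α * pd (hfun g k) i x) ∂μ.1

/-- The second-order operator `𝐋^{(2)}_t` acting on `F(μ) = f(μ(h_1),…,μ(h_n)) ∈ FC²_b(H)`:
the first-order part `⟨∇^{SP}F, b + a∇⟩_{L²(μ)}` plus the Hessian part
`½ ∑_α Hess(F)(σ^α,σ^α)`. -/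
def L2op {d d₁ : ℕ} (a : ℝ → SP d → Rd d → Fin d → Fin d → ℝ)
    (b : ℝ → SP d → Rd d → Fin d → ℝ) (σ : ℝ → SP d → Rd d → Fin d → Fin d₁ → ℝ)
    (g : ℕ → Rd d → ℝ) {n : ℕ} (f : (Fin n → ℝ) → ℝ) (t : ℝ) (μ : SP d) : ℝ :=
  (∑ k : Fin n, pd f k (fun l : Fin n => ∫ x, hfun g l x ∂μ.1) *
      ∫ x, Lop a b t μ (hfun g k) x ∂μ.1) +
    (1/2) * ∑ α : Fin d₁, ∑ k : Fin n, ∑ l : Fin n,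
      pd2 f k l (fun m : Fin n => ∫ x, hfun g m x ∂μ.1) *
        (sigGrad σ g α k t μ * sigGrad σ g α l t μ)

/-- Weakly continuous solution to the second-order equation (SP-FPK) on `P(SP)`. -/
def IsSPFPKSolution (d d₁ : ℕ) (T : ℝ) (a : ℝ → SP d → Rd d → Fin d → Fin d → ℝ)
    (b : ℝ → SP d → Rd d → Fin d → ℝ) (σ : ℝ → SP d → Rd d → Fin d → Fin d₁ → ℝ)
    (g : ℕ → Rd d → ℝ) (Γ : ℝ → Measure (SP d)) : Prop :=
  (∀ t ∈ Set.Icc (0:ℝ) T, IsProbabilityMeasure (Γ t)) ∧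
  (∀ F : SP d → ℝ, Continuous F → (∃ M, ∀ μ, |F μ| ≤ M) →
      ContinuousOn (fun t => ∫ μ, F μ ∂(Γ t)) (Set.Icc 0 T)) ∧
  (∫⁻ t in Set.Ioc (0:ℝ) T, ∫⁻ μ : SP d,
      (∫⁻ x, ENNReal.ofReal ((∑ i, |b t μ x i|) + (∑ i, ∑ j, |a t μ x i j|) +
        ∑ i, ∑ α, (σ t μ x i α) ^ 2) ∂μ.1) ∂(Γ t) < ⊤) ∧
  ∀ (n : ℕ) (f : (Fin n → ℝ) → ℝ), IsC2b f → ∀ t ∈ Set.Icc (0:ℝ) T,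
    ∫ μ, Hof g f μ ∂(Γ t) - ∫ μ, Hof g f μ ∂(Γ 0) =
      ∫ s in (0:ℝ)..t, ∫ μ, L2op a b σ g f s μ ∂(Γ s)

/-- The set `A_t` of subprobability measures integrating the drift and diffusion
coefficients at time `t`. -/
def ASet (d : ℕ) (a : ℝ → SP d → Rd d → Fin d → Fin d → ℝ)
    (b : ℝ → SP d → Rd d → Fin d → ℝ) (t : ℝ) : Set (SP d) :=
  {μ : SP d | ∀ i j, ∫⁻ x, ENNReal.ofReal (|a t μ x i j| + |b t μ x i|) ∂μ.1 < ⊤}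

/-- The drift coefficient `B̄_i(t,z)` on `ℓ²`: `B_i(t, H⁻¹(z)) = ∫ L_{t,H⁻¹(z)} h_i dH⁻¹(z)`
if `z ∈ H(A_t)`, and `0` otherwise. -/
def Bbar (d : ℕ) (H : SP d → E2) (a : ℝ → SP d → Rd d → Fin d → Fin d → ℝ)
    (b : ℝ → SP d → Rd d → Fin d → ℝ) (g : ℕ → Rd d → ℝ)
    (i : ℕ) (t : ℝ) (z : E2) : ℝ :=
  if h : ∃ μ : SP d, H μ = z ∧ μ ∈ ASet d a b t then
    ∫ x, Lop a b t h.choose (hfun g i) x ∂h.choose.1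
  else 0

/-- The diffusion coefficient `Σ̄^α_i(t,z)` on `ℓ²`: `Σ^α_i(t, H⁻¹(z))` if `z ∈ H(SP)`,
and `0` otherwise. -/
def Sbar (d d₁ : ℕ) (H : SP d → E2) (σ : ℝ → SP d → Rd d → Fin d → Fin d₁ → ℝ)
    (g : ℕ → Rd d → ℝ) (α : Fin d₁) (i : ℕ) (t : ℝ) (z : E2) : ℝ :=
  if h : ∃ μ : SP d, H μ = z then sigGrad σ g α i t h.choose else 0

/-- `Ā_{ij} = ∑_α Σ̄^α_i Σ̄^α_j`. -/
def Abar (d d₁ : ℕ) (H : SP d → E2) (σ : ℝ → SP d → Rd d → Fin d → Fin d₁ → ℝ)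
    (g : ℕ → Rd d → ℝ) (i j : ℕ) (t : ℝ) (z : E2) : ℝ :=
  ∑ α : Fin d₁, Sbar d d₁ H σ g α i t z * Sbar d d₁ H σ g α j t z

/-- Weakly continuous solution to the Fokker-Planck-Kolmogorov equation (ℓ²-FPK) for
curves of Borel probability measures on `ℓ²`. -/
def IsL2FPKSolution (T : ℝ) (Bb : ℕ → ℝ → E2 → ℝ) (Ab : ℕ → ℕ → ℝ → E2 → ℝ)
    (Γb : ℝ → Measure E2) : Prop :=
  (∀ t ∈ Set.Icc (0:ℝ) T, IsProbabilityMeasure (Γb t)) ∧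
  (∀ F : E2 → ℝ, Continuous F → (∃ M, ∀ z, |F z| ≤ M) →
      ContinuousOn (fun t => ∫ z, F z ∂(Γb t)) (Set.Icc 0 T)) ∧
  (∀ i j : ℕ, ∫⁻ t in Set.Ioc (0:ℝ) T,
      ∫⁻ z, ENNReal.ofReal (|Bb i t z| + |Ab i j t z|) ∂(Γb t) < ⊤) ∧
  ∀ (n : ℕ) (f : (Fin n → ℝ) → ℝ), IsC2b f → ∀ t ∈ Set.Icc (0:ℝ) T,
    ∫ z, f (fun k : Fin n => (z : ℕ → ℝ) k) ∂(Γb t) =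
      ∫ z, f (fun k : Fin n => (z : ℕ → ℝ) k) ∂(Γb 0) +
        ∫ s in (0:ℝ)..t,
          ∫ z, ((∑ k : Fin n, pd f k (fun l : Fin n => (z : ℕ → ℝ) l) * Bb k s z) +
            (1/2) * ∑ k : Fin n, ∑ l : Fin n,
              pd2 f k l (fun m : Fin n => (z : ℕ → ℝ) m) * Ab k l s z) ∂(Γb s)

lemma SP.continuous_integral {d : ℕ} {φ : Rd d → ℝ} (hφ : Continuous φ)
    (hc : HasCompactSupport φ) : Continuous fun μ : SP d => ∫ x, φ x ∂μ.1 :=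
  continuous_iInf_dom
    (i := (⟨φ, hφ, hc⟩ : {g : Rd d → ℝ // Continuous g ∧ HasCompactSupport g}))
    continuous_induced_dom

instance SP.isFiniteMeasure {d : ℕ} (μ : SP d) : IsFiniteMeasure μ.1 :=
  ⟨μ.2.trans_lt ENNReal.one_lt_top⟩

lemma SP.abs_integral_le {d : ℕ} (μ : SP d) {f : Rd d → ℝ} {C : ℝ} (hC : ∀ x, |f x| ≤ C) :
    |∫ x, f x ∂μ.1| ≤ C := by
  have hC0 : 0 ≤ C := (abs_nonneg _).trans (hC 0)
  have h1 : μ.1.real Set.univ ≤ 1 := by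
    simpa [Measure.real] using ENNReal.toReal_mono ENNReal.one_ne_top μ.2
  calc |∫ x, f x ∂μ.1| ≤ C * μ.1.real Set.univ :=
        (Real.norm_eq_abs _).symm.trans_le
          (norm_integral_le_of_norm_le_const (Eventually.of_forall hC))
    _ ≤ C := mul_le_of_le_one_right hC0 h1

lemma integrable_of_hasCompactSupport {d : ℕ} (μ : SP d) {φ : Rd d → ℝ} (hφ : Continuous φ)
    (hc : HasCompactSupport φ) : Integrable φ μ.1 :=
  hφ.integrable_of_hasCompactSupport hc

open CompactlySupported in
instance SP.compactSpace (d : ℕ) : CompactSpace (SP d) := by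
  refine ⟨isCompact_iff_ultrafilter_le_nhds.2 fun 𝓤 _ => ?_⟩
  have hlim : ∀ φ : C_c(Rd d, ℝ), ∃ l : ℝ,
      Tendsto (fun μ : SP d => ∫ x, φ x ∂μ.1) 𝓤 (𝓝 l) := by
    intro φ
    obtain ⟨C, hC⟩ := φ.continuous.bounded_above_of_compact_support φ.hasCompactSupport
    obtain ⟨l, -, hl⟩ := (isCompact_Icc (a := -C) (b := C)).ultrafilter_le_nhds
      (𝓤.map fun μ : SP d => ∫ x, φ x ∂μ.1) (by
        rw [le_principal_iff]
        exact mem_map.2 (univ_mem' fun μ => abs_le.1 (μ.abs_integral_le hC)))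
    exact ⟨l, hl⟩
  choose Λ hΛ using hlim
  have hint : ∀ (φ : C_c(Rd d, ℝ)) (μ : SP d), Integrable φ μ.1 := fun φ μ =>
    integrable_of_hasCompactSupport μ φ.continuous φ.hasCompactSupport
  let L : C_c(Rd d, ℝ) →ₗ[ℝ] ℝ :=
    { toFun := Λ
      map_add' := fun φ ψ => by
        refine tendsto_nhds_unique (hΛ (φ + ψ)) (((hΛ φ).add (hΛ ψ)).congr fun μ => ?_)
        simp [integral_add (hint φ μ) (hint ψ μ)]
      map_smul' := fun c φ => by
        refine tendsto_nhds_unique (hΛ (c • φ)) (((hΛ φ).const_mul c).congr fun μ => ?_)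
        simp [integral_const_mul] }
  let P : C_c(Rd d, ℝ) →ₚ[ℝ] ℝ := PositiveLinearMap.mk₀ L fun φ hφ =>
    ge_of_tendsto' (hΛ φ) fun μ => integral_nonneg hφ
  let ν : Measure (Rd d) := RealRMK.rieszMeasure P
  have hν : ∀ φ : C_c(Rd d, ℝ), ∫ x, φ x ∂ν = Λ φ := fun φ => RealRMK.integral_rieszMeasure P φ
  have hmass : ν Set.univ ≤ 1 := by
    rw [isOpen_univ.measure_eq_iSup_isCompact]
    refine iSup₂_le fun K _ => iSup_le fun hK => ?_
    obtain ⟨f, hf1, -, hf2, hf3⟩ := exists_continuous_one_zero_of_isCompact hK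
      isClosed_empty (Set.disjoint_empty K)
    let φ : C_c(Rd d, ℝ) := ⟨f, hf2⟩
    refine (RealRMK.rieszMeasure_le_of_eq_one P (f := φ) (fun x => (hf3 x).1) hK
      fun x hx => hf1 hx).trans ?_
    rw [ENNReal.ofReal_le_one]
    refine le_of_tendsto' (hΛ φ) fun μ => (le_abs_self _).trans (μ.abs_integral_le fun x => ?_)
    exact (abs_of_nonneg (hf3 x).1).trans_le (hf3 x).2
  let μ₀ : SP d := ⟨ν, hmass⟩
  refine ⟨μ₀, Set.mem_univ _, ?_⟩
  change (𝓤 : Filter (SP d)) ≤ @nhds (SP d) (⨅ _, _) μ₀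
  rw [nhds_iInf]
  refine le_iInf fun φ => ?_
  rw [nhds_induced, ← map_le_iff_le_comap]
  have h := hΛ ⟨⟨φ.1, φ.2.1⟩, φ.2.2⟩
  rw [← hν] at h
  exact h

lemma exists_isC2c_abs_sub_le {d : ℕ} {φ : Rd d → ℝ} (hφ : Continuous φ)
    (hc : HasCompactSupport φ) {ε : ℝ} (hε : 0 < ε) :
    ∃ ψ, IsC2c ψ ∧ ∀ x, |ψ x - φ x| ≤ ε := by
  obtain ⟨δ, hδ, h⟩ := Metric.uniformContinuous_iff.1
    (hφ.uniformContinuous_of_tendsto_cocompact hc.is_zero_at_infty) ε hε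
  let η : ContDiffBump (0 : Rd d) := ⟨δ / 2, δ, half_pos hδ, half_lt_self hδ⟩
  refine ⟨_, ⟨(η.hasCompactSupport_normed (μ := volume)).contDiff_convolution_left (ContinuousLinearMap.lsmul ℝ ℝ)
    (η.contDiff_normed (μ := volume)) (hφ.locallyIntegrable (μ := volume)),
    (η.hasCompactSupport_normed (μ := volume)).convolution _ hc⟩, fun x => ?_⟩
  exact η.dist_normed_convolution_le hφ.aestronglyMeasurable fun y hy => (h hy).le

lemma GFamily.integral_injective {d : ℕ} {g : ℕ → Rd d → ℝ} (hg : GFamily d g) {μ ν : SP d}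
    (h : ∀ i, ∫ x, g i x ∂μ.1 = ∫ x, g i x ∂ν.1) : μ = ν := by
  refine Subtype.ext (Measure.ext_of_integral_eq_on_compactlySupported fun φ => ?_)
  refine eq_of_forall_dist_le fun ε hε => ?_
  obtain ⟨ψ, hψ, hψφ⟩ :=
    exists_isC2c_abs_sub_le φ.continuous φ.hasCompactSupport (show 0 < ε / 4 by linarith)
  obtain ⟨i, hi, -⟩ := hg.2.2 ψ hψ (ε / 4) (by linarith)
  have key : ∀ ρ : SP d, |(∫ x, g i x ∂ρ.1) - ∫ x, φ x ∂ρ.1| ≤ ε / 2 := by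
    intro ρ
    have hsub := integral_sub
      (integrable_of_hasCompactSupport ρ (hg.1 i).1.continuous (hg.1 i).2)
      (integrable_of_hasCompactSupport ρ φ.continuous φ.hasCompactSupport)
    refine (congrArg abs hsub.symm).trans_le ?_
    refine ρ.abs_integral_le fun x => ?_
    calc |g i x - φ x| ≤ |g i x - ψ x| + |ψ x - φ x| := abs_sub_le _ _ _
      _ ≤ ε / 4 + ε / 4 := add_le_add (hi x) (hψφ x)
      _ = ε / 2 := by ring
  have h1 := abs_le.1 (key μ)
  have h2 := abs_le.1 (key ν)
  rw [h i] at h1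
  rw [Real.dist_eq, abs_le]
  constructor <;> linarith [h1.1, h1.2, h2.1, h2.2]

section C2c

variable {n : ℕ} {φ : (Fin n → ℝ) → ℝ}

lemma IsC2c.contDiff_pd (hφ : IsC2c φ) (i : Fin n) : ContDiff ℝ 1 (pd φ i) :=
  (hφ.1.fderiv_right (by norm_num)).clm_apply contDiff_const

lemma IsC2c.hasCompactSupport_pd (hφ : IsC2c φ) (i : Fin n) : HasCompactSupport (pd φ i) :=
  hφ.2.fderiv_apply ℝ _

lemma IsC2c.continuous_pd2 (hφ : IsC2c φ) (i j : Fin n) : Continuous (pd2 φ i j) :=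
  ((hφ.contDiff_pd j).continuous_fderiv one_ne_zero).clm_apply continuous_const

lemma IsC2c.hasCompactSupport_pd2 (hφ : IsC2c φ) (i j : Fin n) :
    HasCompactSupport (pd2 φ i j) :=
  (hφ.hasCompactSupport_pd j).fderiv_apply ℝ _

lemma IsC2c.const_mul (hφ : IsC2c φ) (c : ℝ) : IsC2c fun x => c * φ x :=
  ⟨contDiff_const.mul hφ.1, hφ.2.mul_left⟩

lemma IsC2c.exists_bound (hφ : IsC2c φ) :
    ∃ M : ℝ, 0 ≤ M ∧ ∀ x, |φ x| ≤ M ∧ (∀ i, |pd φ i x| ≤ M) ∧ ∀ i j, |pd2 φ i j x| ≤ M := by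
  obtain ⟨C, hC⟩ := hφ.1.continuous.bounded_above_of_compact_support hφ.2
  choose C₁ hC₁ using fun i =>
    (hφ.contDiff_pd i).continuous.bounded_above_of_compact_support (hφ.hasCompactSupport_pd i)
  choose C₂ hC₂ using fun i j =>
    (hφ.continuous_pd2 i j).bounded_above_of_compact_support (hφ.hasCompactSupport_pd2 i j)
  have h0 : 0 ≤ C := (norm_nonneg _).trans (hC 0)
  have h1 : ∀ i, 0 ≤ C₁ i := fun i => (norm_nonneg _).trans (hC₁ i 0)
  have h2 : ∀ i j, 0 ≤ C₂ i j := fun i j => (norm_nonneg _).trans (hC₂ i j 0)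
  have s1 : 0 ≤ ∑ i, C₁ i := Finset.sum_nonneg fun i _ => h1 i
  have s2 : 0 ≤ ∑ i, ∑ j, C₂ i j :=
    Finset.sum_nonneg fun i _ => Finset.sum_nonneg fun j _ => h2 i j
  refine ⟨C + ∑ i, C₁ i + ∑ i, ∑ j, C₂ i j, by linarith, fun x => ⟨?_, fun i => ?_, fun i j => ?_⟩⟩
  · linarith [hC x, Real.norm_eq_abs (φ x)]
  · have := Finset.single_le_sum (fun i _ => h1 i) (Finset.mem_univ i)
    linarith [hC₁ i x, Real.norm_eq_abs (pd φ i x)]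
  · have e1 := Finset.single_le_sum (fun j _ => h2 i j) (Finset.mem_univ j)
    have e2 := Finset.single_le_sum (f := fun i => ∑ j, C₂ i j)
      (fun i _ => Finset.sum_nonneg fun j _ => h2 i j) (Finset.mem_univ i)
    linarith [hC₂ i j x, Real.norm_eq_abs (pd2 φ i j x)]

lemma IsC2c.abs_le_c2bNorm (hφ : IsC2c φ) (x : Fin n → ℝ) : |φ x| ≤ c2bNorm φ := by
  obtain ⟨M, hM0, hM⟩ := hφ.exists_bound
  refine (le_max_left _ _).trans (le_ciSup (f := fun x : Fin n → ℝ =>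
    max |φ x| (max (⨆ i, |pd φ i x|) (⨆ i, ⨆ j, |pd2 φ i j x|))) ⟨M, ?_⟩ x)
  rintro _ ⟨y, rfl⟩
  exact max_le (hM y).1 (max_le (Real.iSup_le (hM y).2.1 hM0)
    (Real.iSup_le (fun i => Real.iSup_le ((hM y).2.2 i) hM0) hM0))

lemma IsC2c.c2bNorm_pos (hφ : IsC2c φ) (h0 : φ ≠ 0) : 0 < c2bNorm φ := by
  obtain ⟨x, hx⟩ := Function.ne_iff.1 h0
  exact (abs_pos.2 hx).trans_le (hφ.abs_le_c2bNorm x)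

end C2c

section Chart

variable {d : ℕ} {g : ℕ → Rd d → ℝ}

lemma GFamily.isC2c_hfun (hg : GFamily d g) (i : ℕ) : IsC2c (hfun g i) := by
  convert (hg.1 i).const_mul ((2 : ℝ)⁻¹ ^ (i + 1) * (c2bNorm (g i))⁻¹) using 1
  funext x
  simp only [hfun]
  ring

lemma GFamily.abs_hfun_le (hg : GFamily d g) (i : ℕ) (x : Rd d) :
    |hfun g i x| ≤ (2 : ℝ)⁻¹ ^ (i + 1) := by
  have hpos := (hg.1 i).c2bNorm_pos (hg.2.1 i)
  have : |g i x / c2bNorm (g i)| ≤ 1 := by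
    rw [abs_div, abs_of_pos hpos, div_le_one hpos]
    exact (hg.1 i).abs_le_c2bNorm x
  rw [hfun, abs_mul, abs_of_pos (by positivity)]
  exact mul_le_of_le_one_right (by positivity) this

variable {H : SP d → E2}

lemma GFamily.chart_injective (hg : GFamily d g)
    (hH : ∀ (μ : SP d) (i : ℕ), (H μ : ℕ → ℝ) i = ∫ x, hfun g i x ∂μ.1) :
    Function.Injective H := by
  refine fun μ ν h => hg.integral_injective fun i => ?_
  have hi : ∫ x, hfun g i x ∂μ.1 = ∫ x, hfun g i x ∂ν.1 := by rw [← hH, ← hH, h]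
  simp only [hfun, integral_const_mul, integral_div] at hi
  exact (div_left_inj' ((hg.1 i).c2bNorm_pos (hg.2.1 i)).ne').1
    (mul_left_cancel₀ (by positivity) hi)

lemma GFamily.chart_continuous (hg : GFamily d g)
    (hH : ∀ (μ : SP d) (i : ℕ), (H μ : ℕ → ℝ) i = ∫ x, hfun g i x ∂μ.1) :
    Continuous H := by
  rw [continuous_iff_continuousAt]
  intro μ₀
  have hcont : Continuous fun μ => ∑' i, |(H μ : ℕ → ℝ) i - (H μ₀ : ℕ → ℝ) i| ^ (2 : ℝ) := by
    refine continuous_tsum (u := fun i => (1 / 4 : ℝ) ^ i) (fun i => ?_)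
      (summable_geometric_of_lt_one (by norm_num) (by norm_num)) fun i μ => ?_
    · simp only [hH]
      have := SP.continuous_integral (hg.isC2c_hfun i).1.continuous (hg.isC2c_hfun i).2
      exact (this.sub continuous_const).abs.rpow_const fun _ => Or.inr (by norm_num)
    · have h1 := fun μ : SP d => μ.abs_integral_le (hg.abs_hfun_le i)
      have h2 : |(H μ : ℕ → ℝ) i - (H μ₀ : ℕ → ℝ) i| ≤ (2 : ℝ)⁻¹ ^ i := by
        rw [hH, hH]
        refine (abs_sub _ _).trans ?_
        have := h1 μ
        have := h1 μ₀
        rw [pow_succ] at *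
        linarith
      rw [Real.rpow_two, Real.norm_of_nonneg (by positivity)]
      calc _ ≤ ((2 : ℝ)⁻¹ ^ i) ^ 2 := by gcongr
        _ = (1 / 4 : ℝ) ^ i := by rw [← pow_mul, mul_comm, pow_mul]; norm_num
  have hnorm : ∀ μ, ‖H μ - H μ₀‖ =
      (∑' i, |(H μ : ℕ → ℝ) i - (H μ₀ : ℕ → ℝ) i| ^ (2 : ℝ)) ^ (1 / 2 : ℝ) := by
    intro μ
    rw [lp.norm_eq_tsum_rpow (by norm_num)]
    simp
  rw [ContinuousAt, tendsto_iff_norm_sub_tendsto_zero]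
  simp only [hnorm]
  have := (hcont.rpow_const (p := 1 / 2) fun _ => Or.inr (by norm_num)).tendsto μ₀
  simpa using this

lemma GFamily.isClosedEmbedding_chart (hg : GFamily d g)
    (hH : ∀ (μ : SP d) (i : ℕ), (H μ : ℕ → ℝ) i = ∫ x, hfun g i x ∂μ.1) :
    IsClosedEmbedding H :=
  (hg.chart_continuous hH).isClosedEmbedding (hg.chart_injective hH)

end Chart

lemma measurable_of_measurable_integral {α X : Type*} [MeasurableSpace α] [TopologicalSpace X]
    [HasOuterApproxClosed X] [MeasurableSpace X] [BorelSpace X] {κ : α → Measure X}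
    [∀ a, IsFiniteMeasure (κ a)]
    (h : ∀ f : X → ℝ, Continuous f → (∃ M, ∀ x, |f x| ≤ M) → Measurable fun a => ∫ x, f x ∂κ a) :
    Measurable κ := by
  have hclosed : ∀ F : Set X, IsClosed F → Measurable fun a => κ a F := by
    intro F hF
    refine measurable_of_tendsto_metrizable (f := fun n a => ∫⁻ x, hF.apprSeq n x ∂κ a)
      (fun n => ?_) (tendsto_pi_nhds.2 fun a => HasOuterApproxClosed.tendsto_lintegral_apprSeq hF (κ a))
    have hn := h (fun x => (hF.apprSeq n x : ℝ)) (by fun_prop) ⟨1, fun x => by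
      simpa using HasOuterApproxClosed.apprSeq_apply_le_one hF n x⟩
    convert hn.ennreal_ofReal using 1
    funext a
    rw [← BoundedContinuousFunction.toReal_lintegral_coe_eq_integral,
      ENNReal.ofReal_toReal (BoundedContinuousFunction.lintegral_lt_top_of_nnreal _ _).ne]
  exact Measurable.measure_of_isPiSystem
    ((BorelSpace.measurable_eq (α := X)).trans borel_eq_generateFrom_isClosed)
    isPiSystem_isClosed hclosed (hclosed _ isClosed_univ)

lemma SP.measurable_val (d : ℕ) : Measurable fun μ : SP d => (μ.1 : Measure (Rd d)) := by
  refine measurable_of_measurable_integral fun f hf ⟨M, hM⟩ => ?_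
  let χ : ℕ → Rd d → ℝ := fun n x => max 0 (min 1 (n - ‖x‖))
  have hχ : ∀ n, Continuous (χ n) := fun n => by fun_prop
  have hχ1 : ∀ n x, |χ n x| ≤ 1 := fun n x => by
    rw [abs_of_nonneg (le_max_left _ _)]
    exact max_le zero_le_one (min_le_left _ _)
  have hχc : ∀ n, HasCompactSupport (χ n) := fun n =>
    HasCompactSupport.intro (isCompact_closedBall (0 : Rd d) n) fun x hx => by
      rw [mem_closedBall_zero_iff, not_le] at hx
      exact max_eq_left ((min_le_right _ _).trans (by linarith))
  refine measurable_of_tendsto_metrizable (f := fun n μ => ∫ x, χ n x * f x ∂μ.1)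
    (fun n => (SP.continuous_integral ((hχ n).mul hf) (hχc n).mul_right).measurable)
    (tendsto_pi_nhds.2 fun μ => ?_)
  refine tendsto_integral_of_dominated_convergence (fun _ => M)
    (fun n => ((hχ n).mul hf).aestronglyMeasurable) (integrable_const M)
    (fun n => Eventually.of_forall fun x => ?_) (Eventually.of_forall fun x => ?_)
  · rw [Real.norm_eq_abs, abs_mul]
    exact (mul_le_of_le_one_left (abs_nonneg _) (hχ1 n x)).trans (hM x)
  · refine tendsto_const_nhds.congr' ?_
    filter_upwards [eventually_ge_atTop ⌈‖x‖ + 1⌉₊] with n hn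
    have h1 : ‖x‖ + 1 ≤ n := Nat.ceil_le.1 hn
    have h2 : χ n x = 1 := by
      simp only [χ]
      rw [min_eq_left (by linarith), max_eq_right zero_le_one]
    rw [h2, one_mul]

/-- The total mass `‖b‖_{L¹(μ)} + ‖a‖_{L¹(μ)} + ‖σ‖²_{L²(μ)}` of the coefficients. -/
def coeffMass {d d₁ : ℕ} (a : ℝ → SP d → Rd d → Fin d → Fin d → ℝ)
    (b : ℝ → SP d → Rd d → Fin d → ℝ) (σ : ℝ → SP d → Rd d → Fin d → Fin d₁ → ℝ)
    (t : ℝ) (μ : SP d) : ENNReal :=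
  ∫⁻ x, ENNReal.ofReal ((∑ i, |b t μ x i|) + (∑ i, ∑ j, |a t μ x i j|) +
    ∑ i, ∑ α, (σ t μ x i α) ^ 2) ∂μ.1

section Coefficients

variable {d d₁ : ℕ} {a : ℝ → SP d → Rd d → Fin d → Fin d → ℝ}
  {b : ℝ → SP d → Rd d → Fin d → ℝ} {σ : ℝ → SP d → Rd d → Fin d → Fin d₁ → ℝ}

lemma measurable_coeffMass (hab : GoodCoeffs d a b)
    (hσ : ∀ i α, Measurable fun p : ℝ × SP d × Rd d => σ p.1 p.2.1 p.2.2 i α) :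
    Measurable fun p : ℝ × SP d => coeffMass a b σ p.1 p.2 := by
  let κ : ProbabilityTheory.Kernel (ℝ × SP d) (Rd d) :=
    ⟨fun p => p.2.1, (SP.measurable_val d).comp measurable_snd⟩
  have : ProbabilityTheory.IsFiniteKernel κ := ⟨1, ENNReal.one_lt_top, fun p => p.2.2⟩
  have hassoc : Measurable fun q : (ℝ × SP d) × Rd d => (q.1.1, q.1.2, q.2) := by fun_prop
  have hF : Measurable fun p : ℝ × SP d × Rd d =>
      ENNReal.ofReal ((∑ i, |b p.1 p.2.1 p.2.2 i|) + (∑ i, ∑ j, |a p.1 p.2.1 p.2.2 i j|) +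
        ∑ i, ∑ α, (σ p.1 p.2.1 p.2.2 i α) ^ 2) :=
    (((Finset.measurable_fun_sum _ fun i _ => (hab.2.1 i).abs).add
      (Finset.measurable_fun_sum _ fun i _ => Finset.measurable_fun_sum _ fun j _ =>
        (hab.1 i j).abs)).add
      (Finset.measurable_fun_sum _ fun i _ => Finset.measurable_fun_sum _ fun α _ =>
        (hσ i α).pow_const 2)).ennreal_ofReal
  exact (hF.comp hassoc).lintegral_kernel_prod_right' (κ := κ)

lemma mem_ASet_of_coeffMass_lt_top {t : ℝ} {μ : SP d} (h : coeffMass a b σ t μ < ⊤) :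
    μ ∈ ASet d a b t := by
  refine fun i j => (lintegral_mono fun x => ENNReal.ofReal_le_ofReal ?_).trans_lt h
  have hb := Finset.single_le_sum (f := fun i => |b t μ x i|)
    (fun i _ => abs_nonneg _) (Finset.mem_univ i)
  have ha := Finset.single_le_sum (f := fun j => |a t μ x i j|)
    (fun j _ => abs_nonneg _) (Finset.mem_univ j)
  have ha' := Finset.single_le_sum (f := fun i => ∑ j, |a t μ x i j|)
    (fun i _ => Finset.sum_nonneg fun j _ => abs_nonneg _) (Finset.mem_univ i)
  have hs : 0 ≤ ∑ i, ∑ α, (σ t μ x i α) ^ 2 :=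
    Finset.sum_nonneg fun i _ => Finset.sum_nonneg fun α _ => sq_nonneg _
  linarith

lemma IsC2c.exists_abs_integral_Lop_le {φ : Rd d → ℝ} (hφ : IsC2c φ) :
    ∃ C : ℝ, ∀ (t : ℝ) (μ : SP d),
      ENNReal.ofReal |∫ x, Lop a b t μ φ x ∂μ.1| ≤ ENNReal.ofReal C * coeffMass a b σ t μ := by
  obtain ⟨M, hM0, hM⟩ := hφ.exists_bound
  refine ⟨M, fun t μ => ?_⟩
  rw [coeffMass, ← lintegral_const_mul' _ _ ENNReal.ofReal_ne_top, ← Real.enorm_eq_ofReal_abs]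
  refine (enorm_integral_le_lintegral_enorm _).trans (lintegral_mono fun x => ?_)
  rw [Real.enorm_eq_ofReal_abs, ← ENNReal.ofReal_mul hM0]
  refine ENNReal.ofReal_le_ofReal ?_
  have hs : 0 ≤ ∑ i, ∑ α, (σ t μ x i α) ^ 2 :=
    Finset.sum_nonneg fun i _ => Finset.sum_nonneg fun α _ => sq_nonneg _
  have ha : |∑ i, ∑ j, a t μ x i j * pd2 φ i j x| ≤ M * ∑ i, ∑ j, |a t μ x i j| := by
    simp only [Finset.mul_sum]
    refine (Finset.abs_sum_le_sum_abs _ _).trans (Finset.sum_le_sum fun i _ =>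
      (Finset.abs_sum_le_sum_abs _ _).trans (Finset.sum_le_sum fun j _ => ?_))
    rw [abs_mul, mul_comm]
    exact mul_le_mul_of_nonneg_right ((hM x).2.2 i j) (abs_nonneg _)
  have hb : |∑ i, b t μ x i * pd φ i x| ≤ M * ∑ i, |b t μ x i| := by
    simp only [Finset.mul_sum]
    refine (Finset.abs_sum_le_sum_abs _ _).trans (Finset.sum_le_sum fun i _ => ?_)
    rw [abs_mul, mul_comm]
    exact mul_le_mul_of_nonneg_right ((hM x).2.1 i) (abs_nonneg _)
  have h1 : |Lop a b t μ φ x| ≤ _ := abs_add_le _ _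
  have h2 := mul_nonneg hM0 hs
  rw [mul_add, mul_add]
  linarith

lemma exists_abs_sigGrad_le (hσ : ∃ M : ℝ, ∀ t μ x i α, |σ t μ x i α| ≤ M) {g : ℕ → Rd d → ℝ}
    {k : ℕ} (hk : IsC2c (hfun g k)) : ∃ C : ℝ, ∀ α t μ, |sigGrad σ g α k t μ| ≤ C := by
  obtain ⟨M, hM⟩ := hσ
  obtain ⟨N, hN0, hN⟩ := hk.exists_bound
  refine ⟨∑ _i : Fin d, M * N, fun α t μ => μ.abs_integral_le fun x => ?_⟩
  refine (Finset.abs_sum_le_sum_abs _ _).trans (Finset.sum_le_sum fun i _ => ?_)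
  rw [abs_mul]
  exact mul_le_mul (hM t μ x i α) ((hN x).2.1 i) (abs_nonneg _)
    ((abs_nonneg _).trans (hM t μ x i α))

variable {H : SP d → E2} {g : ℕ → Rd d → ℝ}

lemma Bbar_apply_of_injective (hinj : Function.Injective H) (i : ℕ) (t : ℝ) (μ : SP d) :
    Bbar d H a b g i t (H μ) =
      if μ ∈ ASet d a b t then ∫ x, Lop a b t μ (hfun g i) x ∂μ.1 else 0 := by
  unfold Bbar
  by_cases hμ : μ ∈ ASet d a b t
  · have h : ∃ ν : SP d, H ν = H μ ∧ ν ∈ ASet d a b t := ⟨μ, rfl, hμ⟩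
    rw [dif_pos h, if_pos hμ, hinj h.choose_spec.1]
  · rw [if_neg hμ, dif_neg]
    rintro ⟨ν, hν, hνA⟩
    exact hμ (hinj hν ▸ hνA)

lemma Sbar_apply_of_injective (hinj : Function.Injective H) (α : Fin d₁) (i : ℕ) (t : ℝ)
    (μ : SP d) : Sbar d d₁ H σ g α i t (H μ) = sigGrad σ g α i t μ := by
  have h : ∃ ν : SP d, H ν = H μ := ⟨μ, rfl⟩
  rw [Sbar, dif_pos h, hinj h.choose_spec]

lemma l2Generator_apply_eq_L2op (hinj : Function.Injective H)
    (hH : ∀ (μ : SP d) (i : ℕ), (H μ : ℕ → ℝ) i = ∫ x, hfun g i x ∂μ.1)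
    {n : ℕ} (f : (Fin n → ℝ) → ℝ) {t : ℝ} {μ : SP d} (hμ : μ ∈ ASet d a b t) :
    (∑ k : Fin n, pd f k (fun l : Fin n => (H μ : ℕ → ℝ) l) * Bbar d H a b g k t (H μ)) +
      (1/2) * ∑ k : Fin n, ∑ l : Fin n, pd2 f k l (fun m : Fin n => (H μ : ℕ → ℝ) m) *
        Abar d d₁ H σ g k l t (H μ) = L2op a b σ g f t μ := by
  simp only [Bbar_apply_of_injective hinj, if_pos hμ, Abar, Sbar_apply_of_injective hinj, hH,
    L2op, Finset.mul_sum]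
  congr 1
  rw [Finset.sum_comm (s := (Finset.univ : Finset (Fin d₁)))]
  exact Finset.sum_congr rfl fun k _ => Finset.sum_comm

end Coefficients

/-- Along a weakly continuous curve of probability measures on `SP d`, finiteness of the
integrated coefficient mass implies its finiteness almost everywhere. -/
lemma ae_ae_coeffMass_lt_top {d d₁ : ℕ} {T : ℝ} (hT : 0 < T)
    {a : ℝ → SP d → Rd d → Fin d → Fin d → ℝ} {b : ℝ → SP d → Rd d → Fin d → ℝ}
    {σ : ℝ → SP d → Rd d → Fin d → Fin d₁ → ℝ} (hab : GoodCoeffs d a b)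
    (hσ : ∀ i α, Measurable fun p : ℝ × SP d × Rd d => σ p.1 p.2.1 p.2.2 i α)
    {H : SP d → E2} (hH : IsEmbedding H) {Γ : ℝ → Measure (SP d)}
    (hprob : ∀ t ∈ Set.Icc (0 : ℝ) T, IsProbabilityMeasure (Γ t))
    (hcont : ∀ F : SP d → ℝ, Continuous F → (∃ M, ∀ μ, |F μ| ≤ M) →
      ContinuousOn (fun t => ∫ μ, F μ ∂(Γ t)) (Set.Icc 0 T))
    (hint : ∫⁻ t in Set.Ioc (0 : ℝ) T, ∫⁻ μ, coeffMass a b σ t μ ∂(Γ t) < ⊤) :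
    ∀ᵐ t ∂(volume.restrict (Set.Ioc (0 : ℝ) T)), ∀ᵐ μ ∂(Γ t), coeffMass a b σ t μ < ⊤ := by
  have := hH.metrizableSpace
  let p : ℝ → ℝ := fun t => Set.projIcc 0 T hT.le t
  have hp : ∀ t, p t ∈ Set.Icc 0 T := fun t => (Set.projIcc 0 T hT.le t).2
  have hpt : ∀ t ∈ Set.Ioc 0 T, p t = t := fun t ht =>
    congrArg Subtype.val (Set.projIcc_of_mem hT.le (Set.Ioc_subset_Icc_self ht))
  have hprob' : ∀ t, IsProbabilityMeasure (Γ (p t)) := fun t => hprob _ (hp t)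
  let κ : ProbabilityTheory.Kernel ℝ (SP d) :=
    ⟨fun t => Γ (p t), measurable_of_measurable_integral fun F hF hb =>
      ((hcont F hF hb).comp_continuous (continuous_subtype_val.comp continuous_projIcc)
        hp).measurable⟩
  have : ProbabilityTheory.IsMarkovKernel κ := ⟨hprob'⟩
  have hm := measurable_coeffMass hab hσ
  have hκ : Measurable fun t => ∫⁻ μ, coeffMass a b σ t μ ∂(κ t) :=
    hm.lintegral_kernel_prod_right'
  have hint' : ∫⁻ t in Set.Ioc (0 : ℝ) T, ∫⁻ μ, coeffMass a b σ t μ ∂(κ t) < ⊤ := by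
    refine (setLIntegral_congr_fun measurableSet_Ioc fun t ht => ?_).trans_lt hint
    change ∫⁻ μ, coeffMass a b σ t μ ∂(Γ (p t)) = _
    rw [hpt t ht]
  filter_upwards [ae_lt_top hκ hint'.ne, ae_restrict_mem measurableSet_Ioc] with t ht htT
  have := ae_lt_top (hm.comp measurable_prodMk_left) ht.ne
  change ∀ᵐ μ ∂(Γ (p t)), _ at this
  rwa [hpt t htT] at this

/-- Lemma 4.12: for a weakly continuous solution `(Γ_t)` to (SP-FPK),
the pushforwards `Γ̄_t = Γ_t ∘ H⁻¹` form a weakly continuous solution to (ℓ²-FPK),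
concentrated on `H(SP)`. -/
theorem pushforward_solves_l2FPK (d d₁ : ℕ) (T : ℝ) (hT : 0 < T)
    (a : ℝ → SP d → Rd d → Fin d → Fin d → ℝ) (b : ℝ → SP d → Rd d → Fin d → ℝ)
    (σ : ℝ → SP d → Rd d → Fin d → Fin d₁ → ℝ)
    (hab : GoodCoeffs d a b)
    (hσmeas : ∀ i α, Measurable fun p : ℝ × SP d × Rd d => σ p.1 p.2.1 p.2.2 i α)
    (hσbdd : ∃ M : ℝ, ∀ t μ x i α, |σ t μ x i α| ≤ M)
    (g : ℕ → Rd d → ℝ) (hg : GFamily d g)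
    (H : SP d → E2) (hH : ∀ (μ : SP d) (i : ℕ), (H μ : ℕ → ℝ) i = ∫ x, hfun g i x ∂μ.1)
    (Γ : ℝ → Measure (SP d)) (hΓ : IsSPFPKSolution d d₁ T a b σ g Γ) :
    IsL2FPKSolution T (Bbar d H a b g) (Abar d d₁ H σ g) (fun t => (Γ t).map H) ∧
    ∀ t ∈ Set.Icc (0:ℝ) T, (Γ t).map H (Set.range H) = 1 := by
  obtain ⟨hprob, hcont, hint, heq⟩ := hΓ
  have hemb := hg.isClosedEmbedding_chart hH
  have hme := hemb.measurableEmbedding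
  have hmass := ae_ae_coeffMass_lt_top hT hab hσmeas hemb.toIsEmbedding hprob hcont hint
  have hpush : ∀ t ∈ Set.Icc (0 : ℝ) T, IsProbabilityMeasure ((Γ t).map H) := fun t ht =>
    have := hprob t ht
    Measure.isProbabilityMeasure_map hme.measurable.aemeasurable
  refine ⟨⟨hpush, ?_, ?_, ?_⟩, fun t ht => ?_⟩
  · rintro F hF ⟨M, hM⟩
    simp only [hme.integral_map]
    exact hcont _ (hF.comp hemb.continuous) ⟨M, fun μ => hM _⟩
  · intro i j
    obtain ⟨C, hC⟩ := (hg.isC2c_hfun i).exists_abs_integral_Lop_le (a := a) (b := b) (σ := σ)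
    obtain ⟨Ci, hCi⟩ := exists_abs_sigGrad_le hσbdd (hg.isC2c_hfun i)
    obtain ⟨Cj, hCj⟩ := exists_abs_sigGrad_le hσbdd (hg.isC2c_hfun j)
    have hB : ∀ t μ, ENNReal.ofReal |Bbar d H a b g i t (H μ)| ≤
        ENNReal.ofReal C * coeffMass a b σ t μ := by
      intro t μ
      rw [Bbar_apply_of_injective hemb.injective]
      split_ifs
      · exact hC t μ
      · simp
    have hA : ∀ t μ, |Abar d d₁ H σ g i j t (H μ)| ≤ ∑ _α : Fin d₁, Ci * Cj := by
      intro t μ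
      simp only [Abar, Sbar_apply_of_injective hemb.injective]
      refine (Finset.abs_sum_le_sum_abs _ _).trans (Finset.sum_le_sum fun α _ => ?_)
      rw [abs_mul]
      exact mul_le_mul (hCi α t μ) (hCj α t μ) (abs_nonneg _) ((abs_nonneg _).trans (hCi α t μ))
    set K := ∑ _α : Fin d₁, Ci * Cj
    calc ∫⁻ t in Set.Ioc (0:ℝ) T, ∫⁻ z, ENNReal.ofReal
            (|Bbar d H a b g i t z| + |Abar d d₁ H σ g i j t z|) ∂((Γ t).map H)
        ≤ ∫⁻ t in Set.Ioc (0:ℝ) T, (ENNReal.ofReal C * (∫⁻ μ, coeffMass a b σ t μ ∂(Γ t)) +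
            ENNReal.ofReal K) := by
          refine setLIntegral_mono' measurableSet_Ioc fun t ht => ?_
          have := hprob t (Set.Ioc_subset_Icc_self ht)
          rw [hme.lintegral_map, ← lintegral_const_mul' _ _ ENNReal.ofReal_ne_top]
          calc _ ≤ ∫⁻ μ, (ENNReal.ofReal C * coeffMass a b σ t μ + ENNReal.ofReal K) ∂(Γ t) :=
                lintegral_mono fun μ => ENNReal.ofReal_add_le.trans
                  (add_le_add (hB t μ) (ENNReal.ofReal_le_ofReal (hA t μ)))
            _ = _ := by rw [lintegral_add_right _ measurable_const]; simp
      _ < ⊤ := by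
          rw [lintegral_add_right _ measurable_const,
            lintegral_const_mul' _ _ ENNReal.ofReal_ne_top, lintegral_const]
          exact ENNReal.add_lt_top.2 ⟨ENNReal.mul_lt_top ENNReal.ofReal_lt_top hint,
            ENNReal.mul_lt_top ENNReal.ofReal_lt_top (by simp)⟩
  · intro n f hf t ht
    have hHof : ∀ s, ∫ z, f (fun k : Fin n => (z : ℕ → ℝ) k) ∂((Γ s).map H) =
        ∫ μ, Hof g f μ ∂(Γ s) := fun s => by
      simp only [hme.integral_map, Hof, hH]
    rw [hHof, hHof, ← sub_eq_iff_eq_add', heq n f hf t ht]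
    refine intervalIntegral.integral_congr_ae ?_
    rw [Set.uIoc_of_le ht.1]
    filter_upwards [(ae_restrict_iff' measurableSet_Ioc).1 hmass] with s hs hst
    rw [hme.integral_map]
    refine integral_congr_ae ?_
    filter_upwards [hs (Set.Ioc_subset_Ioc_right ht.2 hst)] with μ hμ
    exact (l2Generator_apply_eq_L2op hemb.injective hH f (mem_ASet_of_coeffMass_lt_top hμ)).symm
  · have := hprob t ht
    rw [hme.map_apply, Set.preimage_range, measure_univ]
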